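/- arXiv:2312.12180 — 4 statements merged into one kernel-verified Lean document; each statement's English description precedes it below -/
import Mathlib

section
/- For every integer n ≥ 3, every real κ with 0 < κ ≤ 1, and every y > 0 such that cosh y / sinh y > 2^{1/(2κ)}, one has ∫_0^{log(cosh y / sinh y)} (sinh(κt)/κ)^{n−2} dt ≥ ((cosh y / sinh y)^{κ(n−2)} − 2^{(n−2)/2}) / ((n−2) · 4^{n−2} · κ^{n−1}). -/
theorem exp_div_four_le_sinh {x : ℝ} (hx : Real.log 2 ≤ 2 * x) :
    Real.exp x / 4 ≤ Real.sinh x := by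
  have h : 2 * Real.exp (-x) ≤ Real.exp x := by
    calc 2 * Real.exp (-x) = Real.exp (Real.log 2 + -x) := by
          rw [Real.exp_add, Real.exp_log two_pos]
      _ ≤ Real.exp x := Real.exp_le_exp.2 (by linarith)
  rw [Real.sinh_eq]
  linarith

theorem integral_exp_mul_div_pow {κ : ℝ} (hκ : 0 < κ) {m : ℕ} (hm : m ≠ 0) (a b : ℝ) :
    ∫ t in a..b, (Real.exp (κ * t) / 4 / κ) ^ m =
      (Real.exp (m * κ * b) - Real.exp (m * κ * a)) / (m * 4 ^ m * κ ^ (m + 1)) := by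
  have hm' : (m : ℝ) ≠ 0 := Nat.cast_ne_zero.2 hm
  have h : ∀ t : ℝ, (Real.exp (κ * t) / 4 / κ) ^ m =
      (4 ^ m * κ ^ m)⁻¹ * Real.exp (m * κ * t) := fun t => by
    rw [div_pow, div_pow, ← Real.exp_nat_mul, mul_assoc (m : ℝ)]
    field_simp
  simp_rw [h]
  rw [intervalIntegral.integral_const_mul,
    intervalIntegral.integral_comp_mul_left (fun t => Real.exp t) (mul_ne_zero hm' hκ.ne'),
    integral_exp, smul_eq_mul, pow_succ]
  field_simp

theorem le_integral_sinh_mul_div_pow {κ : ℝ} (hκ : 0 < κ) {m : ℕ} (hm : m ≠ 0) {b : ℝ}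
    (hb : Real.log 2 / (2 * κ) ≤ b) :
    (Real.exp (m * κ * b) - (2 : ℝ) ^ ((m : ℝ) / 2)) / (m * 4 ^ m * κ ^ (m + 1)) ≤
      ∫ t in (0 : ℝ)..b, (Real.sinh (κ * t) / κ) ^ m := by
  set a := Real.log 2 / (2 * κ) with ha
  have ha0 : 0 ≤ a := div_nonneg (Real.log_nonneg one_le_two) (by positivity)
  have hexp : (2 : ℝ) ^ ((m : ℝ) / 2) = Real.exp (m * κ * a) := by
    rw [Real.rpow_def_of_pos two_pos, ha]
    congr 1
    field_simp
  have hint : ∀ c d : ℝ, IntervalIntegrable (fun t => (Real.sinh (κ * t) / κ) ^ m)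
      MeasureTheory.volume c d := fun c d =>
    Continuous.intervalIntegrable (by fun_prop) c d
  rw [hexp, ← integral_exp_mul_div_pow hκ hm,
    ← intervalIntegral.integral_add_adjacent_intervals (hint 0 a) (hint a b)]
  have hleft : 0 ≤ ∫ t in (0 : ℝ)..a, (Real.sinh (κ * t) / κ) ^ m :=
    intervalIntegral.integral_nonneg ha0 fun t ht =>
      pow_nonneg (div_nonneg (Real.sinh_nonneg_iff.2 (mul_nonneg hκ.le ht.1)) hκ.le) m
  refine le_add_of_nonneg_of_le hleft (intervalIntegral.integral_mono_on hb
    (Continuous.intervalIntegrable (by fun_prop) a b) (hint a b) fun t ht => ?_)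
  have hlog : Real.log 2 ≤ 2 * (κ * t) := by
    have := (div_le_iff₀ (by positivity)).1 ht.1
    linarith
  have := exp_div_four_le_sinh hlog
  gcongr

/-- For every integer `n ≥ 3`, `0 < κ ≤ 1`, and `y > 0` with
`cosh y / sinh y > 2^(1/(2κ))`, one has
`∫_0^{log (cosh y / sinh y)} (sinh (κ t)/κ)^(n-2) dt
  ≥ ((cosh y / sinh y)^(κ(n-2)) − 2^((n-2)/2)) / ((n-2) · 4^(n-2) · κ^(n-1))`. -/
theorem stmt_6 (n : ℕ) (hn : 3 ≤ n) (κ : ℝ) (hκ : 0 < κ) (hκ1 : κ ≤ 1)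
    (y : ℝ) (hy : 0 < y)
    (hcoth : Real.cosh y / Real.sinh y > (2 : ℝ) ^ (1 / (2 * κ))) :
    (∫ t in (0:ℝ)..(Real.log (Real.cosh y / Real.sinh y)),
        (Real.sinh (κ * t) / κ) ^ (n - 2)) ≥
      ((Real.cosh y / Real.sinh y) ^ (κ * ((n : ℝ) - 2)) - (2 : ℝ) ^ (((n : ℝ) - 2) / 2)) /
        (((n : ℝ) - 2) * (4 : ℝ) ^ (n - 2) * κ ^ (n - 1)) := by
  obtain ⟨m, rfl⟩ := Nat.exists_eq_add_of_le' (show 2 ≤ n by omega)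
  have hpos : 0 < Real.cosh y / Real.sinh y :=
    div_pos (Real.cosh_pos y) (Real.sinh_pos_iff.2 hy)
  have hb : Real.log 2 / (2 * κ) ≤ Real.log (Real.cosh y / Real.sinh y) := by
    have := Real.log_le_log (by positivity) hcoth.le
    rwa [Real.log_rpow two_pos, one_div_mul_eq_div] at this
  have h := le_integral_sinh_mul_div_pow hκ (m := m) (by omega) hb
  have hcast : ((m + 2 : ℕ) : ℝ) - 2 = m := by push_cast; ring
  rw [hcast, Nat.add_sub_cancel, show m + 2 - 1 = m + 1 by omega, Real.rpow_def_of_pos hpos,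
    show Real.log (Real.cosh y / Real.sinh y) * (κ * m) =
      m * κ * Real.log (Real.cosh y / Real.sinh y) by ring]
  exact h
end

section
/- For every integer n ≥ 3, every real κ with 0 < κ ≤ 1, and every y > 0, one has (cosh y / sinh y)^{κ(n−2)} ≤ (n−2) · 4^{n−2} · κ^{n−1} · ∫_0^{log(cosh y / sinh y)} (sinh(κt)/κ)^{n−2} dt + 2^{(n−2)/2}. -/
/-- Past `log √2`, the function `4 sinh` dominates `exp`. -/
theorem Real.exp_le_four_mul_sinh {s : ℝ} (hs : Real.log 2 / 2 ≤ s) :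
    Real.exp s ≤ 4 * Real.sinh s := by
  have h : (2 : ℝ) ≤ Real.exp s * Real.exp s := by
    rw [← Real.exp_add, ← Real.log_le_iff_le_exp two_pos]
    linarith
  have hinv : Real.exp s * Real.exp (-s) = 1 := by rw [← Real.exp_add]; simp
  have hpos := Real.exp_pos s
  have hneg := Real.exp_pos (-s)
  rw [Real.sinh_eq]
  nlinarith

theorem Real.exp_mul_le_integral_sinh_pow (m : ℕ) {x : ℝ} (hx : 0 ≤ x) :
    Real.exp (m * x) ≤
      m * (4 : ℝ) ^ m * (∫ s in (0:ℝ)..x, Real.sinh s ^ m) + (2 : ℝ) ^ ((m : ℝ) / 2) := by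
  have hint (a b : ℝ) : IntervalIntegrable (fun s => Real.sinh s ^ m) MeasureTheory.volume a b :=
    (Real.continuous_sinh.pow m).intervalIntegrable a b
  have hsinh {s : ℝ} (hs : 0 ≤ s) : 0 ≤ Real.sinh s ^ m :=
    pow_nonneg (Real.sinh_nonneg_iff.2 hs) m
  have hlog : 0 ≤ Real.log 2 / 2 := by positivity
  have htwo : (2 : ℝ) ^ ((m : ℝ) / 2) = Real.exp (m * (Real.log 2 / 2)) := by
    rw [Real.rpow_def_of_pos two_pos]
    ring_nf
  rw [htwo]
  rcases le_total x (Real.log 2 / 2) with h | h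
  · have hI : 0 ≤ ∫ s in (0:ℝ)..x, Real.sinh s ^ m :=
      intervalIntegral.integral_nonneg hx fun s hs => hsinh hs.1
    have hexp : Real.exp (m * x) ≤ Real.exp (m * (Real.log 2 / 2)) := by gcongr
    have : 0 ≤ m * (4 : ℝ) ^ m * ∫ s in (0:ℝ)..x, Real.sinh s ^ m := by positivity
    linarith
  · have hftc : ∫ s in (Real.log 2 / 2)..x, m * Real.exp (m * s) =
        Real.exp (m * x) - Real.exp (m * (Real.log 2 / 2)) := by
      refine intervalIntegral.integral_eq_sub_of_hasDerivAt
        (f := fun s : ℝ => Real.exp (m * s)) (fun s _ => ?_)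
        (Continuous.intervalIntegrable (by fun_prop) _ _)
      simpa [mul_comm] using ((hasDerivAt_id s).const_mul (m : ℝ)).exp
    have hmono : ∫ s in (Real.log 2 / 2)..x, m * Real.exp (m * s) ≤
        ∫ s in (Real.log 2 / 2)..x, m * (4 : ℝ) ^ m * Real.sinh s ^ m := by
      refine intervalIntegral.integral_mono_on h
        (Continuous.intervalIntegrable (by fun_prop) _ _) ((hint _ _).const_mul _) fun s hs => ?_
      rw [Real.exp_nat_mul, mul_assoc, ← mul_pow]
      have := Real.exp_le_four_mul_sinh hs.1
      gcongr
    have hI : 0 ≤ ∫ s in (0:ℝ)..(Real.log 2 / 2), Real.sinh s ^ m :=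
      intervalIntegral.integral_nonneg hlog fun s hs => hsinh hs.1
    have hsub : m * (4 : ℝ) ^ m * (∫ s in (Real.log 2 / 2)..x, Real.sinh s ^ m) ≤
        m * (4 : ℝ) ^ m * ∫ s in (0:ℝ)..x, Real.sinh s ^ m := by
      rw [← intervalIntegral.integral_add_adjacent_intervals (hint 0 (Real.log 2 / 2)) (hint _ x)]
      gcongr
      linarith
    rw [intervalIntegral.integral_const_mul (m * (4 : ℝ) ^ m)] at hmono
    linarith


/-- For every integer `n ≥ 3`, `0 < κ ≤ 1`, and every `y > 0`,
`(cosh y / sinh y)^(κ(n-2)) ≤ (n-2) · 4^(n-2) · κ^(n-1) · ∫_0^{log (cosh y / sinh y)} (sinh (κt)/κ)^(n-2) dt + 2^((n-2)/2)`. -/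
theorem stmt_7 (n : ℕ) (hn : 3 ≤ n) (κ : ℝ) (hκ : 0 < κ) (hκ1 : κ ≤ 1)
    (y : ℝ) (hy : 0 < y) :
    (Real.cosh y / Real.sinh y) ^ (κ * ((n : ℝ) - 2)) ≤
      ((n : ℝ) - 2) * (4 : ℝ) ^ (n - 2) * κ ^ (n - 1) *
        (∫ t in (0:ℝ)..(Real.log (Real.cosh y / Real.sinh y)),
          (Real.sinh (κ * t) / κ) ^ (n - 2)) + (2 : ℝ) ^ (((n : ℝ) - 2) / 2) := by
  obtain ⟨m, rfl⟩ : ∃ m, n = m + 2 := ⟨n - 2, by omega⟩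
  have hm : ((m + 2 : ℕ) : ℝ) - 2 = m := by push_cast; ring
  have hsinh : 0 < Real.sinh y := Real.sinh_pos_iff.2 hy
  have hcoth : 1 ≤ Real.cosh y / Real.sinh y :=
    (one_le_div hsinh).2 (Real.sinh_lt_cosh y).le
  have hL : 0 ≤ Real.log (Real.cosh y / Real.sinh y) := Real.log_nonneg hcoth
  rw [hm, Real.rpow_def_of_pos (by linarith), show m + 2 - 2 = m by omega,
    show m + 2 - 1 = m + 1 by omega]
  set L := Real.log (Real.cosh y / Real.sinh y)
  have hsubst : κ ^ (m + 1) * (∫ t in (0:ℝ)..L, (Real.sinh (κ * t) / κ) ^ m) =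
      ∫ s in (0:ℝ)..(κ * L), Real.sinh s ^ m := by
    have h := intervalIntegral.mul_integral_comp_mul_left (a := 0) (b := L)
      (f := fun s => Real.sinh s ^ m) κ
    rw [mul_zero] at h
    rw [← h]
    simp only [div_pow, intervalIntegral.integral_div]
    field_simp
    ring
  rw [mul_assoc _ (κ ^ (m + 1)), hsubst, show L * (κ * m) = m * (κ * L) by ring]
  exact Real.exp_mul_le_integral_sinh_pow m (by positivity)
end

section
/- For every integer n ≥ 3, every real κ with 0 < κ ≤ 1, and every constant C > 0, there exists a constant c > 0 (depending only on n, κ, C) such that for all y > 0: if A := ∫_0^{log(cosh y / sinh y)} (sinh(κt)/κ)^{n−2} dt satisfies A ≥ C, then y ≥ c · A^{−1/(κ(n−2))}. -/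
theorem Real.sinh_le_mul_cosh {y : ℝ} (hy : 0 ≤ y) : Real.sinh y ≤ y * Real.cosh y := by
  have hmono : MonotoneOn (fun x : ℝ => x * Real.cosh x - Real.sinh x) (Set.Ici 0) := by
    refine monotoneOn_of_hasDerivWithinAt_nonneg (f' := fun x => x * Real.sinh x)
      (convex_Ici 0) (by fun_prop) (fun x _ => ?_) (fun x hx => ?_)
    · refine ((((hasDerivAt_id' x).mul (Real.hasDerivAt_cosh x)).sub
        (Real.hasDerivAt_sinh x)).congr_deriv ?_).hasDerivWithinAt
      ring
    · rw [interior_Ici] at hx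
      exact mul_nonneg (le_of_lt hx) (Real.sinh_nonneg_iff.2 (le_of_lt hx))
  have h := hmono Set.self_mem_Ici hy hy
  simpa using h

theorem Real.mul_exp_le_sinh {a x : ℝ} (h : a ≤ x) :
    (1 - Real.exp (-2 * a)) / 2 * Real.exp x ≤ Real.sinh x := by
  have h1 : Real.exp (-x) ≤ Real.exp (-2 * a) * Real.exp x := by
    rw [← Real.exp_add]
    exact Real.exp_le_exp.2 (by linarith)
  rw [Real.sinh_eq]
  linarith

theorem pow_le_integral_sinh_pow {κ : ℝ} (hκ : 0 < κ) (m : ℕ) {L : ℝ} (hL : 1 ≤ L) :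
    (Real.sinh (κ * (L - 1)) / κ) ^ m ≤ ∫ t in (0:ℝ)..L, (Real.sinh (κ * t) / κ) ^ m := by
  have hcont : Continuous fun t : ℝ => (Real.sinh (κ * t) / κ) ^ m := by fun_prop
  have hnn : ∀ t : ℝ, 0 ≤ t → 0 ≤ Real.sinh (κ * t) / κ := fun t ht =>
    div_nonneg (Real.sinh_nonneg_iff.2 (by positivity)) hκ.le
  calc (Real.sinh (κ * (L - 1)) / κ) ^ m
      = ∫ _ in (L - 1)..L, (Real.sinh (κ * (L - 1)) / κ) ^ m := by simp
    _ ≤ ∫ t in (L - 1)..L, (Real.sinh (κ * t) / κ) ^ m := by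
      refine intervalIntegral.integral_mono_on (by linarith) (by simp)
        (hcont.intervalIntegrable _ _) fun t ht => ?_
      refine pow_le_pow_left₀ (hnn _ (by linarith)) ?_ m
      have : Real.sinh (κ * (L - 1)) ≤ Real.sinh (κ * t) :=
        Real.sinh_le_sinh.2 (mul_le_mul_of_nonneg_left ht.1 hκ.le)
      gcongr
    _ ≤ ∫ t in (0:ℝ)..L, (Real.sinh (κ * t) / κ) ^ m := by
      refine intervalIntegral.integral_mono_interval (by linarith) (by linarith) le_rfl ?_
        (hcont.intervalIntegrable _ _)
      refine (MeasureTheory.ae_restrict_iff' measurableSet_Ioc).2 (.of_forall fun t ht => ?_)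
      exact pow_nonneg (hnn t ht.1.le) m

/-- Near `y = 0` the integral grows at least like `y ^ (-κ m)`. -/
theorem exists_mul_rpow_le_integral_sinh_pow {κ : ℝ} (hκ : 0 < κ) (m : ℕ) :
    ∃ B : ℝ, 0 < B ∧ ∀ y : ℝ, 0 < y → y ≤ Real.exp (-2) →
      B * y ^ (-(κ * m)) ≤ ∫ t in (0:ℝ)..(Real.log (Real.cosh y / Real.sinh y)),
          (Real.sinh (κ * t) / κ) ^ m := by
  have ha : 0 < (1 - Real.exp (-2 * κ)) / 2 := by
    have : Real.exp (-2 * κ) < 1 := Real.exp_lt_one_iff.2 (by linarith)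
    linarith
  refine ⟨((1 - Real.exp (-2 * κ)) / 2 * Real.exp (-κ) / κ) ^ m, by positivity,
    fun y hy hy2 => ?_⟩
  have hlog : Real.log y ≤ -2 := (Real.log_le_iff_le_exp hy).2 hy2
  have hs : 0 < Real.sinh y := Real.sinh_pos_iff.2 hy
  have hL : -Real.log y ≤ Real.log (Real.cosh y / Real.sinh y) := by
    rw [← Real.log_inv]
    refine Real.log_le_log (by positivity) ?_
    rw [le_div_iff₀ hs, inv_mul_le_iff₀ hy]
    exact Real.sinh_le_mul_cosh hy.le
  set L := Real.log (Real.cosh y / Real.sinh y)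
  refine le_trans ?_ (pow_le_integral_sinh_pow hκ m (L := L) (by linarith))
  rw [Real.rpow_def_of_pos hy, show Real.log y * -(κ * m) = m * (κ * -Real.log y) by ring,
    Real.exp_nat_mul, ← mul_pow]
  refine pow_le_pow_left₀ (by positivity) ?_ m
  rw [div_mul_eq_mul_div]
  gcongr
  have hle : Real.exp (κ * -Real.log y) ≤ Real.exp (κ * L) := by gcongr
  calc _ ≤ (1 - Real.exp (-2 * κ)) / 2 * Real.exp (-κ) * Real.exp (κ * L) := by gcongr
    _ = (1 - Real.exp (-2 * κ)) / 2 * Real.exp (κ * (L - 1)) := by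
      rw [mul_assoc, ← Real.exp_add]; ring_nf
    _ ≤ _ := Real.mul_exp_le_sinh (by nlinarith)

/-- For every integer `n ≥ 3`, `0 < κ ≤ 1`, and every constant `C > 0`, there exists
`c > 0` such that for all `y > 0`: if
`A := ∫_0^{log (cosh y / sinh y)} (sinh (κt)/κ)^(n-2) dt` satisfies `A ≥ C`, then
`y ≥ c · A^(-1/(κ(n-2)))`. -/
theorem stmt_8 (n : ℕ) (hn : 3 ≤ n) (κ : ℝ) (hκ : 0 < κ) (hκ1 : κ ≤ 1)
    (C : ℝ) (hC : 0 < C) :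
    ∃ c : ℝ, 0 < c ∧ ∀ y : ℝ, 0 < y →
      (∫ t in (0:ℝ)..(Real.log (Real.cosh y / Real.sinh y)),
          (Real.sinh (κ * t) / κ) ^ (n - 2)) ≥ C →
      y ≥ c * (∫ t in (0:ℝ)..(Real.log (Real.cosh y / Real.sinh y)),
          (Real.sinh (κ * t) / κ) ^ (n - 2)) ^ (-1 / (κ * ((n : ℝ) - 2))) := by
  obtain ⟨B, hB, hbound⟩ := exists_mul_rpow_le_integral_sinh_pow hκ (n - 2)
  rw [Nat.cast_sub (by lia), Nat.cast_ofNat] at hbound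
  have hn2 : (0:ℝ) < (n : ℝ) - 2 := by
    have : (3:ℝ) ≤ n := by exact_mod_cast hn
    linarith
  have hq : 0 < κ * ((n : ℝ) - 2) := by positivity
  rw [neg_div, one_div]
  set q := κ * ((n : ℝ) - 2)
  have hp : -q⁻¹ ≤ 0 := by simpa using hq.le
  refine ⟨min (Real.exp (-2) * C ^ q⁻¹) (B ^ q⁻¹), by positivity, fun y hy hA => ?_⟩
  have hbound_y := hbound y hy
  set A := ∫ t in (0:ℝ)..(Real.log (Real.cosh y / Real.sinh y)),
    (Real.sinh (κ * t) / κ) ^ (n - 2)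
  have hA0 : 0 < A := hC.trans_le hA
  rcases le_total y (Real.exp (-2)) with h | h
  · calc _ ≤ B ^ q⁻¹ * A ^ (-q⁻¹) := by gcongr; exact min_le_right _ _
      _ ≤ B ^ q⁻¹ * (B * y ^ (-q)) ^ (-q⁻¹) := by
        gcongr ?_ * ?_
        exact Real.rpow_le_rpow_of_nonpos (by positivity) (hbound_y h) hp
      _ = y := by
        rw [Real.mul_rpow hB.le (by positivity), ← mul_assoc, ← Real.rpow_add hB,
          ← Real.rpow_mul hy.le]
        simp [hq.ne']
  · calc _ ≤ Real.exp (-2) * C ^ q⁻¹ * A ^ (-q⁻¹) := by gcongr; exact min_le_left _ _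
      _ ≤ Real.exp (-2) * C ^ q⁻¹ * C ^ (-q⁻¹) := by
        gcongr ?_ * ?_
        exact Real.rpow_le_rpow_of_nonpos hC hA hp
      _ = Real.exp (-2) := by
        rw [mul_assoc, ← Real.rpow_add hC]
        simp
      _ ≤ y := h
end

section
/- Let n ≥ 2 be an integer, let κ satisfy 0 < κ ≤ 1, let R > 0 be real, and let f : ℝ → ℝ be differentiable on [0, R] with continuous derivative f' on [0, R] and with f(R) = 0. Then ∫_0^R f'(t)² · (cosh(κt))^{n−1} dt ≥ (κ(n−1)/2^{n−1}) · f(0)². -/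
/-- `cosh x ^ m` dominates `exp (m x) / 2 ^ m`. -/
theorem exp_mul_div_two_pow_le_cosh_pow (m : ℕ) (x : ℝ) :
    Real.exp (m * x) / 2 ^ m ≤ Real.cosh x ^ m := by
  have h : Real.exp x / 2 ≤ Real.cosh x := by
    rw [Real.cosh_eq]
    linarith [Real.exp_pos (-x)]
  calc Real.exp (m * x) / 2 ^ m = (Real.exp x / 2) ^ m := by rw [Real.exp_nat_mul, div_pow]
    _ ≤ Real.cosh x ^ m := by gcongr

/-- A one-dimensional weighted Steklov–Dirichlet inequality with exponential weight. -/
theorem mul_sq_le_integral_sq_mul_exp {a R : ℝ} (ha : 0 < a) (hR : 0 ≤ R) {f f' : ℝ → ℝ}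
    (hf : ∀ t ∈ Set.Icc (0 : ℝ) R, HasDerivWithinAt f (f' t) (Set.Icc 0 R) t)
    (hf' : ContinuousOn f' (Set.Icc 0 R)) (hfR : f R = 0) :
    a * f 0 ^ 2 ≤ ∫ t in (0 : ℝ)..R, f' t ^ 2 * Real.exp (a * t) := by
  set c := a * f 0 with hc
  have hg : ContinuousOn (fun t => -2 * c * f' t - c ^ 2 * Real.exp (-(a * t)))
      (Set.Icc 0 R) := by fun_prop
  have hftc : ∫ t in (0 : ℝ)..R, (-2 * c * f' t - c ^ 2 * Real.exp (-(a * t))) =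
      (-2 * c * f R + c ^ 2 / a * Real.exp (-(a * R))) -
        (-2 * c * f 0 + c ^ 2 / a * Real.exp (-(a * 0))) := by
    refine intervalIntegral.integral_eq_sub_of_hasDerivAt_of_le
      (f := fun t => -2 * c * f t + c ^ 2 / a * Real.exp (-(a * t))) hR ?_ ?_
      (hg.intervalIntegrable_of_Icc hR)
    · have hfc : ContinuousOn f (Set.Icc 0 R) := fun t ht => (hf t ht).continuousWithinAt
      fun_prop
    · intro t ht
      have h1 := ((hf t (Set.Ioo_subset_Icc_self ht)).hasDerivAt
        (Icc_mem_nhds ht.1 ht.2)).const_mul (-2 * c)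
      have h2 := (((hasDerivAt_id t).const_mul a).neg.exp).const_mul (c ^ 2 / a)
      refine (h1.add h2).congr_deriv ?_
      simp only [Pi.neg_apply, id]
      field_simp
      ring
  have hmono : ∫ t in (0 : ℝ)..R, (-2 * c * f' t - c ^ 2 * Real.exp (-(a * t))) ≤
      ∫ t in (0 : ℝ)..R, f' t ^ 2 * Real.exp (a * t) := by
    refine intervalIntegral.integral_mono_on hR (hg.intervalIntegrable_of_Icc hR)
      (ContinuousOn.intervalIntegrable_of_Icc hR (by fun_prop)) fun t _ => ?_
    have hE : Real.exp (a * t) * Real.exp (-(a * t)) = 1 := by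
      rw [← Real.exp_add, add_neg_cancel, Real.exp_zero]
    have hsq : 0 ≤ Real.exp (a * t) * (f' t + c * Real.exp (-(a * t))) ^ 2 := by positivity
    have hexpand : Real.exp (a * t) * (f' t + c * Real.exp (-(a * t))) ^ 2 =
        f' t ^ 2 * Real.exp (a * t) + 2 * c * f' t + c ^ 2 * Real.exp (-(a * t)) := by
      linear_combination (2 * c * f' t + c ^ 2 * Real.exp (-(a * t))) * hE
    linarith
  have hpos : 0 ≤ c ^ 2 / a * Real.exp (-(a * R)) := by positivity
  have hca : c ^ 2 / a = a * f 0 ^ 2 := by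
    rw [hc]
    field_simp
  have hcf : c * f 0 = a * f 0 ^ 2 := by
    rw [hc]
    ring
  rw [hftc, hfR, mul_zero a, neg_zero, Real.exp_zero] at hmono
  linarith


/-- Let `n ≥ 2`, `0 < κ ≤ 1`, `R > 0`, and let `f` be differentiable on `[0, R]` with
continuous derivative `f'` on `[0, R]` and `f R = 0`. Then
`∫_0^R f'(t)² · (cosh (κt))^(n-1) dt ≥ (κ(n-1)/2^(n-1)) · f(0)²`. -/
theorem stmt_13 (n : ℕ) (hn : 2 ≤ n) (κ : ℝ) (hκ : 0 < κ) (hκ1 : κ ≤ 1)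
    (R : ℝ) (hR : 0 < R) (f f' : ℝ → ℝ)
    (hf : ∀ t ∈ Set.Icc (0:ℝ) R, HasDerivWithinAt f (f' t) (Set.Icc 0 R) t)
    (hf' : ContinuousOn f' (Set.Icc 0 R))
    (hfR : f R = 0) :
    (∫ t in (0:ℝ)..R, f' t ^ 2 * (Real.cosh (κ * t)) ^ (n - 1)) ≥
      κ * ((n : ℝ) - 1) / 2 ^ (n - 1) * f 0 ^ 2 := by
  obtain ⟨m, rfl⟩ : ∃ m, n = m + 1 := ⟨n - 1, by omega⟩
  have hm : (0 : ℝ) < m := by exact_mod_cast (by omega : 0 < m)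
  have hexp := mul_sq_le_integral_sq_mul_exp (mul_pos hm hκ) hR.le hf hf' hfR
  have hmono : ∫ t in (0 : ℝ)..R, f' t ^ 2 * Real.exp (m * κ * t) / 2 ^ m ≤
      ∫ t in (0 : ℝ)..R, f' t ^ 2 * Real.cosh (κ * t) ^ m := by
    refine intervalIntegral.integral_mono_on hR.le
      (ContinuousOn.intervalIntegrable_of_Icc hR.le (by fun_prop))
      (ContinuousOn.intervalIntegrable_of_Icc hR.le (by fun_prop)) fun t _ => ?_
    rw [mul_div_assoc, mul_assoc]
    exact mul_le_mul_of_nonneg_left (exp_mul_div_two_pow_le_cosh_pow m (κ * t)) (sq_nonneg _)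
  rw [intervalIntegral.integral_div] at hmono
  rw [ge_iff_le, Nat.add_sub_cancel]
  refine le_trans ?_ hmono
  calc κ * (((m + 1 : ℕ) : ℝ) - 1) / 2 ^ m * f 0 ^ 2 = m * κ * f 0 ^ 2 / 2 ^ m := by
        push_cast
        ring
    _ ≤ _ := by gcongr
end
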